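/- arXiv:0908.1060 — 2 statements merged into one kernel-verified Lean document; each statement's English description precedes it below -/
import Mathlib

section
/- (Uniform estimates for the approximating problems.) Assume 𝓕 satisfies (F1), (F2) and (F3). Then there exists κ > 0 such that for every ε ∈ (0,R) and every continuous f : [0,R] → ℝ the problem 𝓕(u''(r), u'(r)/r, u'(r), u(r), r) − κ·u(r) = f(r) for r ∈ (ε,R), with u'(ε) = 0 and u(R) = 0, has a unique solution u_ε ∈ C²(ε,R) ∩ C¹([ε,R]); moreover, for each fixed continuous f there exists a constant C > 0, independent of ε, such that |u_ε'(r)/r| ≤ C and |u_ε''(r)| ≤ C for all ε ∈ (0,R) and all r ∈ [ε,R]. -/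
open Set

/-- The radial Pucci-type maximal operator `P⁺(x,y) = Λ(x⁺+(N-1)y⁺) - λ(x⁻+(N-1)y⁻)`. -/
noncomputable def Pplus (N : ℕ) (lam Lam : ℝ) (x y : ℝ) : ℝ :=
  Lam * (max x 0 + ((N : ℝ) - 1) * max y 0) - lam * (max (-x) 0 + ((N : ℝ) - 1) * max (-y) 0)

/-- The radial Pucci-type minimal operator `P⁻(x,y) = λ(x⁺+(N-1)y⁺) - Λ(x⁻+(N-1)y⁻)`. -/
noncomputable def Pminus (N : ℕ) (lam Lam : ℝ) (x y : ℝ) : ℝ :=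
  lam * (max x 0 + ((N : ℝ) - 1) * max y 0) - Lam * (max (-x) 0 + ((N : ℝ) - 1) * max (-y) 0)

/-- `u ∈ C²(e,R) ∩ C¹([e,R])`, with first derivative `u'` (one-sided at the endpoints)
and second derivative `u''` on the open interval. -/
def RadC2 (e R : ℝ) (u u' u'' : ℝ → ℝ) : Prop :=
  (∀ r ∈ Set.Icc e R, HasDerivWithinAt u (u' r) (Set.Icc e R) r) ∧
  ContinuousOn u' (Set.Icc e R) ∧
  (∀ r ∈ Set.Ioo e R, HasDerivAt u' (u'' r) r) ∧
  ContinuousOn u'' (Set.Ioo e R)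

/-- A globally Lipschitz, time-continuous vector field on the plane has a solution through every
initial value on the whole time interval. -/
theorem exists_hasDerivWithinAt_Icc_of_lipschitz {a b : ℝ} (hab : a ≤ b) {K : NNReal}
    {v : ℝ → ℝ × ℝ → ℝ × ℝ} (hv : ∀ t ∈ Icc a b, LipschitzWith K (v t))
    (hc : ∀ x, ContinuousOn (fun t => v t x) (Icc a b)) (x₀ : ℝ × ℝ) :
    ∃ α : ℝ → ℝ × ℝ, α a = x₀ ∧
      ∀ t ∈ Icc a b, HasDerivWithinAt α (v t (α t)) (Icc a b) t := by
  obtain ⟨C, hC⟩ := isCompact_Icc.exists_bound_of_continuousOn (hc 0)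
  have hC0 : 0 ≤ C := (norm_nonneg _).trans (hC a (left_mem_Icc.2 hab))
  have hgrow : ∀ t ∈ Icc a b, ∀ x, ‖v t x‖ ≤ K * ‖x‖ + C := by
    intro t ht x
    have h1 := (hv t ht).dist_le_mul x 0
    rw [dist_eq_norm, dist_zero_right] at h1
    have h2 := norm_sub_norm_le (v t x) (v t 0)
    linarith [hC t ht]
  set M : ℝ := max 0 (gronwallBound ‖x₀‖ K C (b - a)) with hM
  have hM0 : 0 ≤ M := le_max_left _ _
  set π : ℝ × ℝ → ℝ × ℝ := fun x => (max (-M) (min M x.1), max (-M) (min M x.2)) with hπ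
  have hπL : LipschitzWith 1 π := by
    have h : ∀ i : ℝ × ℝ → ℝ, LipschitzWith 1 i →
        LipschitzWith 1 (fun x => max (-M) (min M (i x))) :=
      fun i hi => (hi.const_min M).const_max (-M)
    simpa using (h _ LipschitzWith.prod_fst).prodMk (h _ LipschitzWith.prod_snd)
  have hclamp : ∀ y : ℝ, |max (-M) (min M y)| ≤ |y| ∧ |max (-M) (min M y)| ≤ M := by
    intro y
    constructor
    · rw [abs_le]
      constructor
      · rcases le_total M y with h | h
        · rw [min_eq_left h]
          exact le_trans (by linarith [abs_nonneg y]) (le_max_right _ _)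
        · rw [min_eq_right h]
          exact (neg_abs_le y).trans (le_max_right _ _)
      · rcases le_total (-M) (min M y) with h | h
        · rw [max_eq_right h]; exact (min_le_right _ _).trans (le_abs_self y)
        · rw [max_eq_left h]; linarith [abs_nonneg y]
    · rw [abs_le]
      exact ⟨le_max_left _ _, max_le (by linarith) (min_le_left _ _)⟩
  have hπ1 : ∀ x, ‖π x‖ ≤ ‖x‖ := fun x =>
    max_le_max (hclamp x.1).1 (hclamp x.2).1
  have hπ2 : ∀ x, ‖π x‖ ≤ M := fun x => max_le (hclamp x.1).2 (hclamp x.2).2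
  have hπ3 : ∀ x, ‖x‖ ≤ M → π x = x := by
    intro x hx
    have h : ∀ y : ℝ, |y| ≤ M → max (-M) (min M y) = y := by
      intro y hy
      rw [min_eq_right (le_of_abs_le hy), max_eq_right (neg_le_of_abs_le hy)]
    exact Prod.ext (h _ ((norm_fst_le x).trans hx)) (h _ ((norm_snd_le x).trans hx))
  have hPL : IsPicardLindelof (fun t x => v t (π x)) (⟨a, left_mem_Icc.2 hab⟩ : Icc a b) x₀
      ((K * M + C) * (b - a)).toNNReal 0 (K * M + C).toNNReal K := by
    have hKM : 0 ≤ K * M + C := by positivity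
    constructor
    · intro t ht
      have := ((hv t ht).comp hπL).lipschitzOnWith (s := Metric.closedBall x₀
        ((K * M + C) * (b - a)).toNNReal)
      rw [mul_one] at this
      exact this
    · intro x _
      exact hc _
    · intro t ht x _
      rw [Real.coe_toNNReal _ hKM]
      exact (hgrow t ht _).trans (by gcongr; exact hπ2 x)
    · rw [Real.coe_toNNReal _ hKM, Real.coe_toNNReal _ (mul_nonneg hKM (sub_nonneg.2 hab))]
      simp [hab]
  obtain ⟨α, h0, hα⟩ := hPL.exists_eq_forall_mem_Icc_hasDerivWithinAt₀
  refine ⟨α, h0, fun t ht => ?_⟩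
  have hbound : ∀ t ∈ Icc a b, ‖α t‖ ≤ gronwallBound ‖x₀‖ K C (t - a) := by
    refine norm_le_gronwallBound_of_norm_deriv_right_le (f' := fun t => v t (π (α t)))
      (fun t ht => (hα t ht).continuousWithinAt) (fun t ht => ?_) (by rw [← h0]) fun t ht => ?_
    · exact ((hα t (Ico_subset_Icc_self ht)).mono_of_mem_nhdsWithin
        (Icc_mem_nhdsGE_of_mem ht))
    · exact (hgrow t (Ico_subset_Icc_self ht) _).trans (by gcongr; exact hπ1 _)
  have : π (α t) = α t := by
    apply hπ3
    refine (hbound t ht).trans (le_trans ?_ (le_max_right _ _))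
    exact gronwallBound_mono (norm_nonneg _) hC0 K.2 (by linarith [ht.2])
  simpa [this] using hα t ht

/-- Maximum principle on an interval: a function with zero slope at the left endpoint, whose
derivative increases wherever the function is large and the derivative is small, stays below its
threshold. -/
theorem le_of_deriv_pos_of_small_slope {a b A : ℝ} {w w' w'' : ℝ → ℝ} (hab : a < b)
    (hw : ∀ r ∈ Icc a b, HasDerivWithinAt w (w' r) (Icc a b) r)
    (hw' : ContinuousOn w' (Icc a b)) (hw'' : ∀ r ∈ Ioo a b, HasDerivAt w' (w'' r) r)
    (ha : w' a = 0) (hb : w b ≤ A)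
    (hpos : ∀ m > A, ∃ η > 0, ∀ r ∈ Ioo a b, m < w r → |w' r| < η → 0 < w'' r) :
    ∀ r ∈ Icc a b, w r ≤ A := by
  have hwc : ContinuousOn w (Icc a b) := fun r hr => (hw r hr).continuousWithinAt
  obtain ⟨x, hx, hmax⟩ := isCompact_Icc.exists_isMaxOn (nonempty_Icc.2 hab.le) hwc
  intro r hr
  by_contra! hrA
  have hxA : A < w x := hrA.trans_le (hmax hr)
  have hxb : x < b := lt_of_le_of_ne hx.2 (by rintro rfl; linarith)
  have hx0 : w' x = 0 := by
    rcases hx.1.eq_or_lt with h | h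
    · rw [← h, ha]
    · have hn := Icc_mem_nhds h hxb
      exact (hmax.isLocalMax hn).hasDerivAt_eq_zero ((hw x hx).hasDerivAt hn)
  obtain ⟨η, hη, hp⟩ := hpos ((A + w x) / 2) (by linarith)
  have h1 : ∀ᶠ y in nhdsWithin x (Icc a b), (A + w x) / 2 < w y :=
    (hwc x hx).eventually_const_lt (by linarith)
  have h2 : ∀ᶠ y in nhdsWithin x (Icc a b), |w' y| < η :=
    (hw' x hx).abs.eventually_lt_const (by simpa [hx0])
  have hle : nhdsWithin x (Ici x) ≤ nhdsWithin x (Icc a b) :=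
    nhdsWithin_le_iff.2 (Icc_mem_nhdsGE_of_mem ⟨hx.1, hxb⟩)
  obtain ⟨c, hc, hsub⟩ := (mem_nhdsGE_iff_exists_Ico_subset' hxb).1 (hle (h1.and h2))
  set d := min ((x + c) / 2) b with hd
  have hxc : x < c := hc
  have hxd : x < d := lt_min (by linarith) hxb
  have hdc : d < c := (min_le_left _ _).trans_lt (by linarith)
  have hdb : d ≤ b := min_le_right _ _
  have hss : Icc x d ⊆ Icc a b := Icc_subset_Icc hx.1 hdb
  have hmono' : StrictMonoOn w' (Icc x d) := by
    refine strictMonoOn_of_deriv_pos (convex_Icc x d) (hw'.mono hss) fun y hy => ?_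
    rw [interior_Icc] at hy
    have hyab : y ∈ Ioo a b := ⟨hx.1.trans_lt hy.1, hy.2.trans_le hdb⟩
    have := hsub (show y ∈ Ico x c from ⟨hy.1.le, hy.2.trans hdc⟩)
    rw [(hw'' y hyab).deriv]
    exact hp y hyab this.1 this.2
  have hmono : StrictMonoOn w (Icc x d) := by
    refine strictMonoOn_of_deriv_pos (convex_Icc x d) (hwc.mono hss) fun y hy => ?_
    rw [interior_Icc] at hy
    have hyab : y ∈ Ioo a b := ⟨hx.1.trans_lt hy.1, hy.2.trans_le hdb⟩
    rw [((hw y (Ioo_subset_Icc_self hyab)).hasDerivAt (Icc_mem_nhds hyab.1 hyab.2)).deriv, ← hx0]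
    exact hmono' (left_mem_Icc.2 hxd.le) (Ioo_subset_Icc_self hy) hy.1
  have := hmono (left_mem_Icc.2 hxd.le) (right_mem_Icc.2 hxd.le) hxd
  exact absurd (hmax (hss (right_mem_Icc.2 hxd.le))) (not_le.2 this)

/-- A continuous function which is nonpositive at the left endpoint and decreases wherever it is
positive is nonpositive. -/
theorem nonpos_of_deriv_neg_of_pos {a b : ℝ} {h h' : ℝ → ℝ} (hc : ContinuousOn h (Icc a b))
    (hd : ∀ r ∈ Ioo a b, HasDerivAt h (h' r) r) (ha : h a ≤ 0)
    (hneg : ∀ r ∈ Ioo a b, 0 < h r → h' r < 0) : ∀ r ∈ Icc a b, h r ≤ 0 := by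
  intro T hT
  by_contra! hpos
  set S := Icc a T ∩ h ⁻¹' Iic 0 with hS
  have hTs : Icc a T ⊆ Icc a b := Icc_subset_Icc_right hT.2
  have hSc : IsCompact S :=
    isCompact_Icc.of_isClosed_subset
      ((hc.mono hTs).preimage_isClosed_of_isClosed isClosed_Icc isClosed_Iic) inter_subset_left
  obtain ⟨s, hs, hsmax⟩ := hSc.exists_isGreatest ⟨a, left_mem_Icc.2 hT.1, ha⟩
  have hsT : s < T := lt_of_le_of_ne hs.1.2 (by rintro rfl; exact absurd hs.2 (not_le.2 hpos))
  have hanti : StrictAntiOn h (Icc s T) := by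
    refine strictAntiOn_of_deriv_neg (convex_Icc s T)
      (hc.mono (Icc_subset_Icc hs.1.1 hT.2)) fun y hy => ?_
    rw [interior_Icc] at hy
    have hyab : y ∈ Ioo a b := ⟨hs.1.1.trans_lt hy.1, hy.2.trans_le hT.2⟩
    rw [(hd y hyab).deriv]
    refine hneg y hyab (not_le.1 fun hle => ?_)
    exact absurd (hsmax ⟨⟨hyab.1.le, hy.2.le⟩, hle⟩) (not_le.2 hy.1)
  have := hanti (left_mem_Icc.2 hsT.le) (right_mem_Icc.2 hsT.le) hsT
  have h2 : h s ≤ 0 := hs.2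
  linarith

/-- One-sided Grönwall estimate from a vanishing initial value, where the differential inequality
is only known at points at which the function is positive. -/
theorem le_mul_sub_of_deriv_le_of_pos {a b k c : ℝ} {q q' : ℝ → ℝ} (hk : 0 ≤ k) (hc : 0 ≤ c)
    (hq : ContinuousOn q (Icc a b)) (hd : ∀ r ∈ Ioo a b, HasDerivAt q (q' r) r) (ha : q a = 0)
    (hle : ∀ r ∈ Ioo a b, 0 < q r → q' r ≤ c + k * q r) :
    ∀ r ∈ Icc a b, q r ≤ (c + 1) * Real.exp (k * (b - a)) * (r - a) := by
  have key : ∀ r ∈ Icc a b, Real.exp (-(k * (r - a))) * q r - (c + 1) * (r - a) ≤ 0 := by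
    refine nonpos_of_deriv_neg_of_pos
      (h' := fun r => Real.exp (-(k * (r - a))) * (-k) * q r + Real.exp (-(k * (r - a))) * q' r
        - (c + 1)) (by fun_prop) (fun r hr => ?_) (by simp [ha]) fun r hr hpos => ?_
    · have h1 : HasDerivAt (fun r : ℝ => r - a) 1 r := (hasDerivAt_id r).sub_const a
      have h2 : HasDerivAt (fun r => Real.exp (-(k * (r - a))))
          (Real.exp (-(k * (r - a))) * (-k)) r := by
        simpa using (h1.const_mul k).neg.exp
      have := (h2.mul (hd r hr)).sub (h1.const_mul (c + 1))
      rw [mul_one] at this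
      exact this
    · have hra : 0 < r - a := sub_pos.2 hr.1
      have he : 0 < Real.exp (-(k * (r - a))) := Real.exp_pos _
      have he1 : Real.exp (-(k * (r - a))) ≤ 1 := Real.exp_le_one_iff.2 (by nlinarith)
      have hq0 : 0 < q r := by
        have : 0 < Real.exp (-(k * (r - a))) * q r := by nlinarith
        exact (pos_iff_pos_of_mul_pos this).1 he
      have := mul_le_mul_of_nonneg_left (hle r hr hq0) he.le
      nlinarith
  intro r hr
  have h := key r hr
  have hra : 0 ≤ r - a := sub_nonneg.2 hr.1
  have h1 : q r ≤ (c + 1) * (r - a) * Real.exp (k * (r - a)) := by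
    rw [Real.exp_neg] at h
    have he := Real.exp_pos (k * (r - a))
    calc q r = (Real.exp (k * (r - a)))⁻¹ * q r * Real.exp (k * (r - a)) := by field_simp
      _ ≤ _ := mul_le_mul_of_nonneg_right (by linarith) he.le
  calc q r ≤ (c + 1) * (r - a) * Real.exp (k * (r - a)) := h1
    _ ≤ (c + 1) * (r - a) * Real.exp (k * (b - a)) := by gcongr; exact hr.2
    _ = _ := by ring

/-- The shooting method: if differences of solutions with zero initial slope obey a comparison
principle, then the mixed problem with zero slope on the left and zero value on the right is
solvable. -/
theorem exists_solution_of_comparison {a b : ℝ} (hab : a ≤ b) {K : NNReal}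
    {g : ℝ → ℝ × ℝ → ℝ} (hg : ∀ t ∈ Icc a b, LipschitzWith K (g t))
    (hc : ∀ x, ContinuousOn (fun t => g t x) (Icc a b))
    (hcomp : ∀ α β : ℝ → ℝ × ℝ,
      (∀ t ∈ Icc a b, HasDerivWithinAt α ((α t).2, g t (α t)) (Icc a b) t) →
      (∀ t ∈ Icc a b, HasDerivWithinAt β ((β t).2, g t (β t)) (Icc a b) t) →
      (α a).2 = 0 → (β a).2 = 0 → ∀ A : ℝ, 0 ≤ A → (α b).1 - (β b).1 ≤ A →
      (α a).1 - (β a).1 ≤ A) :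
    ∃ α : ℝ → ℝ × ℝ,
      (∀ t ∈ Icc a b, HasDerivWithinAt α ((α t).2, g t (α t)) (Icc a b) t) ∧
      (α a).2 = 0 ∧ (α b).1 = 0 := by
  have hv : ∀ t ∈ Icc a b, LipschitzWith (max 1 K) (fun x : ℝ × ℝ => (x.2, g t x)) :=
    fun t ht => LipschitzWith.prod_snd.prodMk (hg t ht)
  choose α hα0 hα using fun s : ℝ => exists_hasDerivWithinAt_Icc_of_lipschitz hab hv
    (fun x => continuousOn_const.prodMk (hc x)) (s, 0)
  have hlip : ∀ s s' : ℝ, dist (α s b).1 (α s' b).1 ≤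
      Real.exp ((max 1 K : NNReal) * (b - a)) * dist s s' := by
    intro s s'
    have hd : ∀ s, ∀ t ∈ Ico a b, HasDerivWithinAt (α s) ((α s t).2, g t (α s t)) (Ici t) t :=
      fun s t ht => (hα s t (Ico_subset_Icc_self ht)).mono_of_mem_nhdsWithin
        (Icc_mem_nhdsGE_of_mem ht)
    have h := dist_le_of_trajectories_ODE_of_mem (s := fun _ => univ) (δ := dist s s')
      (fun t ht => (hv t (Ico_subset_Icc_self ht)).lipschitzOnWith)
      (fun t ht => (hα s t ht).continuousWithinAt) (hd s) (fun _ _ => mem_univ _)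
      (fun t ht => (hα s' t ht).continuousWithinAt) (hd s') (fun _ _ => mem_univ _)
      (by simp [hα0, Prod.dist_eq]) b (right_mem_Icc.2 hab)
    rw [mul_comm]
    exact (le_max_left _ _).trans h
  have hcont : Continuous fun s => (α s b).1 :=
    (LipschitzWith.of_dist_le_mul (K := ⟨_, (Real.exp_pos _).le⟩) hlip).continuous
  have hmono : ∀ s s' : ℝ, s' < s → s - s' ≤ (α s b).1 - (α s' b).1 := by
    intro s s' hss
    have h := hcomp (α s) (α s') (hα s) (hα s') (by simp [hα0]) (by simp [hα0])
      (max 0 ((α s b).1 - (α s' b).1)) (le_max_left _ _) (le_max_right _ _)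
    simp only [hα0] at h
    rcases le_max_iff.1 h with h | h
    · linarith
    · exact h
  set y := (α 0 b).1 with hy
  obtain ⟨s, hs⟩ : (0 : ℝ) ∈ range fun s => (α s b).1 := by
    refine mem_range_of_exists_le_of_exists_ge hcont ⟨-(|y| + 1), ?_⟩ ⟨|y| + 1, ?_⟩
    · have := hmono 0 (-(|y| + 1)) (by linarith [abs_nonneg y])
      linarith [le_abs_self y]
    · have := hmono (|y| + 1) 0 (by linarith [abs_nonneg y])
      linarith [neg_abs_le y]
  exact ⟨α s, hα s, by simp [hα0], hs⟩

theorem Pplus_le {N : ℕ} (hN : 1 ≤ N) {lam Lam : ℝ} (hlam : 0 ≤ lam) (x y : ℝ) :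
    Pplus N lam Lam x y ≤ Lam * max x 0 - lam * max (-x) 0 + Lam * (N - 1) * max y 0 := by
  have hN' : (0 : ℝ) ≤ N - 1 := sub_nonneg.2 (by exact_mod_cast hN)
  have h : 0 ≤ lam * ((N - 1) * max (-y) 0) := by positivity
  unfold Pplus
  linarith

theorem le_Pminus {N : ℕ} (hN : 1 ≤ N) {lam Lam : ℝ} (hlam : 0 ≤ lam) (x y : ℝ) :
    lam * max x 0 - Lam * max (-x) 0 - Lam * (N - 1) * max (-y) 0 ≤ Pminus N lam Lam x y := by
  have hN' : (0 : ℝ) ≤ N - 1 := sub_nonneg.2 (by exact_mod_cast hN)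
  have h : 0 ≤ lam * ((N - 1) * max y 0) := by positivity
  unfold Pminus
  linarith

theorem RadC2.sub {a b : ℝ} {u u' u'' v v' v'' : ℝ → ℝ} (hu : RadC2 a b u u' u'')
    (hv : RadC2 a b v v' v'') :
    RadC2 a b (fun r => u r - v r) (fun r => u' r - v' r) (fun r => u'' r - v'' r) :=
  ⟨fun r hr => (hu.1 r hr).sub (hv.1 r hr), hu.2.1.sub hv.2.1,
    fun r hr => (hu.2.2.1 r hr).sub (hv.2.2.1 r hr), hu.2.2.2.sub hv.2.2.2⟩

theorem radC2_zero (a b : ℝ) : RadC2 a b (fun _ => 0) (fun _ => 0) (fun _ => 0) :=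
  ⟨fun r _ => hasDerivWithinAt_const r _ 0, continuousOn_const,
    fun r _ => hasDerivAt_const r 0, continuousOn_const⟩

/-- Comparison principle for radial solutions with zero slope at the inner boundary. -/
theorem RadC2.sub_le {a b lam Lam c gam del κ A : ℝ} (ha : 0 < a) (hab : a < b) (hlam : 0 < lam)
    (hc : 0 ≤ c) (hgam : 0 ≤ gam) (hκ : del < κ) (hA : 0 ≤ A)
    {FF : ℝ → ℝ → ℝ → ℝ → ℝ → ℝ}
    (hP : ∀ m l p u m' l' p' u' : ℝ, ∀ r ∈ Ioo a b,
      FF m l p u r - FF m' l' p' u' r ≤ Lam * max (m - m') 0 - lam * max (-(m - m')) 0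
        + c * |l - l'| + gam * |p - p'| + del * |u - u'|)
    {f₁ f₂ u u' u'' v v' v'' : ℝ → ℝ} (hu : RadC2 a b u u' u'') (hv : RadC2 a b v v' v'')
    (hu_eq : ∀ r ∈ Ioo a b, FF (u'' r) (u' r / r) (u' r) (u r) r - κ * u r = f₁ r)
    (hv_eq : ∀ r ∈ Ioo a b, FF (v'' r) (v' r / r) (v' r) (v r) r - κ * v r = f₂ r)
    (hf : ∀ r ∈ Ioo a b, f₂ r - f₁ r ≤ (κ - del) * A)
    (hua : u' a = 0) (hva : v' a = 0) (hb : u b - v b ≤ A) :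
    ∀ r ∈ Icc a b, u r - v r ≤ A := by
  have hw := hu.sub hv
  refine le_of_deriv_pos_of_small_slope hab hw.1 hw.2.1 hw.2.2.1 (by simp [hua, hva]) hb
    fun m hm => ?_
  have hD : 0 < c / a + gam + 1 := by positivity
  have hκ' : 0 < κ - del := sub_pos.2 hκ
  have hmA : 0 < m - A := sub_pos.2 hm
  refine ⟨(κ - del) * (m - A) / (c / a + gam + 1), by positivity, fun r hr hmr hη => ?_⟩
  by_contra! hneg
  have hr0 : 0 < r := ha.trans hr.1
  have h := hP (u'' r) (u' r / r) (u' r) (u r) (v'' r) (v' r / r) (v' r) (v r) r hr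
  rw [max_eq_right hneg, ← sub_div, abs_div, abs_of_pos hr0,
    abs_of_pos (show 0 < u r - v r by linarith)] at h
  have h1 : 0 ≤ lam * max (-(u'' r - v'' r)) 0 := by positivity
  have h2 : c * (|u' r - v' r| / r) ≤ c / a * |u' r - v' r| := by
    rw [mul_div_assoc', div_mul_eq_mul_div]
    exact div_le_div_of_nonneg_left (by positivity) ha hr.1.le
  rw [lt_div_iff₀ hD] at hη
  have h3 : (κ - del) * m < (κ - del) * (u r - v r) := mul_lt_mul_of_pos_left hmr hκ'
  have := hu_eq r hr
  have := hv_eq r hr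
  have := hf r hr
  nlinarith [abs_nonneg (u' r - v' r)]

/-- Solvability of the mixed boundary value problem for a uniformly elliptic radial operator which
obeys a comparison principle. -/
theorem exists_radC2_solution {a b lam Lam c gam del κ : ℝ} (ha : 0 < a) (hab : a < b)
    (hlam : 0 < lam) (hc : 0 ≤ c) (hgam : 0 ≤ gam) (hdel : 0 ≤ del) (hκ : del < κ)
    {FF : ℝ → ℝ → ℝ → ℝ → ℝ → ℝ} {f : ℝ → ℝ} (hfc : ContinuousOn f (Icc a b))
    (hFcont : ContinuousOn
      (fun z : ℝ × ℝ × ℝ × ℝ × ℝ => FF z.1 z.2.1 z.2.2.1 z.2.2.2.1 z.2.2.2.2)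
      {z : ℝ × ℝ × ℝ × ℝ × ℝ | z.2.2.2.2 ∈ Icc a b})
    (hP : ∀ m l p u m' l' p' u' : ℝ, ∀ r ∈ Icc a b,
      FF m l p u r - FF m' l' p' u' r ≤ Lam * max (m - m') 0 - lam * max (-(m - m')) 0
        + c * |l - l'| + gam * |p - p'| + del * |u - u'|)
    (hE : ∀ m l p u m' l' p' u' : ℝ, ∀ r ∈ Icc a b,
      lam * |m - m'| ≤ |FF m l p u r - FF m' l' p' u' r|
        + c * |l - l'| + gam * |p - p'| + del * |u - u'|) :
    ∃ u u' u'' : ℝ → ℝ, RadC2 a b u u' u'' ∧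
      (∀ r ∈ Ioo a b, FF (u'' r) (u' r / r) (u' r) (u r) r - κ * u r = f r) ∧
      u' a = 0 ∧ u b = 0 := by
  have hr0 : ∀ r ∈ Icc a b, 0 < r := fun r hr => ha.trans_le hr.1
  have hsolve : ∀ l p u y r : ℝ, ∃ m, r ∈ Icc a b → FF m l p u r = y := by
    intro l p u y r
    by_cases hr : r ∈ Icc a b
    swap
    · exact ⟨0, fun h => absurd h hr⟩
    have hcm : Continuous fun m => FF m l p u r := by
      rw [← continuousOn_univ]
      exact hFcont.comp (f := fun m : ℝ => ((m, l, p, u, r) : ℝ × ℝ × ℝ × ℝ × ℝ))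
        (by fun_prop) fun _ _ => hr
    set d := |FF 0 l p u r - y| / lam with hd
    have hd0 : 0 ≤ d := by positivity
    have hld : lam * d = |FF 0 l p u r - y| := by rw [hd]; field_simp
    obtain ⟨m, hm⟩ : y ∈ range fun m => FF m l p u r := by
      refine mem_range_of_exists_le_of_exists_ge hcm ⟨-d, ?_⟩ ⟨d, ?_⟩
      · have h := hP (-d) l p u 0 l p u r hr
        simp only [sub_zero, sub_self, abs_zero, mul_zero, add_zero, neg_neg, max_eq_left hd0,
          max_eq_right (neg_nonpos.2 hd0)] at h
        linarith [le_abs_self (FF 0 l p u r - y)]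
      · have h := hP 0 l p u d l p u r hr
        simp only [zero_sub, sub_self, abs_zero, mul_zero, add_zero, neg_neg, max_eq_left hd0,
          max_eq_right (neg_nonpos.2 hd0)] at h
        linarith [neg_abs_le (FF 0 l p u r - y)]
    exact ⟨m, fun _ => hm⟩
  choose G hG using hsolve
  set g : ℝ → ℝ × ℝ → ℝ := fun t x => G (x.2 / t) x.2 x.1 (f t + κ * x.1) t with hg
  have hFg : ∀ t ∈ Icc a b, ∀ x : ℝ × ℝ, FF (g t x) (x.2 / t) x.2 x.1 t = f t + κ * x.1 :=
    fun t ht x => hG _ _ _ _ _ ht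
  have hgc : ∀ α : ℝ → ℝ × ℝ, ContinuousOn α (Icc a b) →
      ContinuousOn (fun t => g t (α t)) (Icc a b) := by
    intro α hα t₀ ht₀
    have hα1 : ContinuousOn (fun t => (α t).1) (Icc a b) := continuous_fst.comp_continuousOn hα
    have hα2 : ContinuousOn (fun t => (α t).2) (Icc a b) := continuous_snd.comp_continuousOn hα
    set Φ : ℝ → ℝ := fun t => |f t + κ * (α t).1
      - FF (g t₀ (α t₀)) ((α t).2 / t) (α t).2 (α t).1 t| / lam with hΦ
    have hFα : ContinuousOn
        (fun t => FF (g t₀ (α t₀)) ((α t).2 / t) (α t).2 (α t).1 t) (Icc a b) :=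
      hFcont.comp (f := fun t => ((g t₀ (α t₀), (α t).2 / t, (α t).2, (α t).1, t) :
        ℝ × ℝ × ℝ × ℝ × ℝ))
        (continuousOn_const.prodMk ((hα2.div continuousOn_id fun t ht => (hr0 t ht).ne').prodMk
          (hα2.prodMk (hα1.prodMk continuousOn_id)))) fun t ht => ht
    have hΦc : ContinuousOn Φ (Icc a b) :=
      (((hfc.add (continuousOn_const.mul hα1)).sub hFα).abs).div_const lam
    have hΦ0 : Φ t₀ = 0 := by simp [hΦ, hFg t₀ ht₀]
    have hlim := hΦc t₀ ht₀
    rw [ContinuousWithinAt, hΦ0] at hlim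
    refine tendsto_iff_norm_sub_tendsto_zero.2 (squeeze_zero' (.of_forall fun _ => norm_nonneg _)
      (eventually_mem_nhdsWithin.mono fun t ht => ?_) hlim)
    have h := hE (g t (α t)) ((α t).2 / t) (α t).2 (α t).1 (g t₀ (α t₀)) ((α t).2 / t) (α t).2
      (α t).1 t ht
    rw [hFg t ht] at h
    rw [hΦ, Real.norm_eq_abs, le_div_iff₀ hlam, mul_comm]
    simpa using h
  have hK : 0 ≤ (κ + c / a + gam + del) / lam := by
    have : 0 < κ := hdel.trans_lt hκ
    positivity
  have hglip : ∀ t ∈ Icc a b,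
      LipschitzWith ((κ + c / a + gam + del) / lam).toNNReal (g t) := by
    intro t ht
    refine LipschitzWith.of_dist_le_mul fun x y => ?_
    have h := hE (g t x) (x.2 / t) x.2 x.1 (g t y) (y.2 / t) y.2 y.1 t ht
    rw [hFg t ht, hFg t ht, ← sub_div, abs_div, abs_of_pos (hr0 t ht), add_sub_add_left_eq_sub,
      ← mul_sub, abs_mul, abs_of_pos (hdel.trans_lt hκ)] at h
    have h1 : |x.1 - y.1| ≤ dist x y := le_max_left _ _
    have h2 : |x.2 - y.2| ≤ dist x y := le_max_right _ _
    have h3 : c * (|x.2 - y.2| / t) ≤ c / a * dist x y := by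
      rw [mul_div_assoc', div_mul_eq_mul_div]
      exact div_le_div₀ (by positivity) (by gcongr) ha ht.1
    have hκ0 : 0 ≤ κ := hdel.trans hκ.le
    have h4 := mul_le_mul_of_nonneg_left h1 hκ0
    have h5 := mul_le_mul_of_nonneg_left h1 hdel
    have h6 := mul_le_mul_of_nonneg_left h2 hgam
    rw [Real.dist_eq, Real.coe_toNNReal _ hK, div_mul_eq_mul_div, le_div_iff₀ hlam]
    linarith
  have hrad : ∀ α : ℝ → ℝ × ℝ,
      (∀ t ∈ Icc a b, HasDerivWithinAt α ((α t).2, g t (α t)) (Icc a b) t) →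
      RadC2 a b (fun t => (α t).1) (fun t => (α t).2) (fun t => g t (α t)) ∧
      ∀ r ∈ Ioo a b, FF (g r (α r)) ((α r).2 / r) (α r).2 (α r).1 r - κ * (α r).1 = f r := by
    intro α hα
    have hαc : ContinuousOn α (Icc a b) := fun t ht => (hα t ht).continuousWithinAt
    refine ⟨⟨fun r hr => ?_, continuous_snd.comp_continuousOn hαc, fun r hr => ?_,
      (hgc α hαc).mono Ioo_subset_Icc_self⟩, fun r hr => ?_⟩
    · simpa using (hasDerivWithinAt_iff_hasFDerivWithinAt.1 (hα r hr)).fst.hasDerivWithinAt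
    · have h : HasDerivWithinAt (fun t => (α t).2) (g r (α r)) (Icc a b) r := by
        simpa using (hasDerivWithinAt_iff_hasFDerivWithinAt.1
          (hα r (Ioo_subset_Icc_self hr))).snd.hasDerivWithinAt
      exact h.hasDerivAt (Icc_mem_nhds hr.1 hr.2)
    · rw [hFg r (Ioo_subset_Icc_self hr)]
      ring
  obtain ⟨α, hα, hαa, hαb⟩ := exists_solution_of_comparison hab.le hglip
    (fun x => hgc (fun _ => x) continuousOn_const) fun α β hα hβ hαa hβa A hA hAb =>
      (hrad α hα).1.sub_le ha hab hlam hc hgam hκ hA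
        (fun m l p u m' l' p' u' r hr => hP m l p u m' l' p' u' r (Ioo_subset_Icc_self hr))
        (hrad β hβ).1 (hrad α hα).2 (hrad β hβ).2
        (fun r _ => by rw [sub_self]; exact mul_nonneg (sub_nonneg.2 hκ.le) hA)
        hαa hβa hAb a (left_mem_Icc.2 hab.le)
  exact ⟨_, _, _, (hrad α hα).1, (hrad α hα).2, hαa, hαb⟩

/-- uniform estimates for the approximating problems on `(ε,R)`:
there is `κ > 0` (independent of `ε`) such that each approximating problem is uniquely
solvable, and for each fixed continuous `f` the solutions satisfy bounds on `u'/r`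
and `u''` independent of `ε`. -/
theorem stmt_16
    (N : ℕ) (hN : 1 ≤ N) (R lam Lam gam del : ℝ) (hR : 0 < R)
    (hlam : 0 < lam) (hLam : lam ≤ Lam) (hgam : 0 < gam) (hdel : 0 < del)
    (FF : ℝ → ℝ → ℝ → ℝ → ℝ → ℝ)
    (hFcont : ContinuousOn
      (fun z : ℝ × ℝ × ℝ × ℝ × ℝ => FF z.1 z.2.1 z.2.2.1 z.2.2.2.1 z.2.2.2.2)
      {z : ℝ × ℝ × ℝ × ℝ × ℝ | z.2.2.2.2 ∈ Icc 0 R})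
    (hF1 : ∀ s : ℝ, 0 ≤ s → ∀ m l p u : ℝ, ∀ r ∈ Icc (0 : ℝ) R,
      FF (s * m) (s * l) (s * p) (s * u) r = s * FF m l p u r)
    (hF2 : ∀ m l p u m' l' p' u' : ℝ, ∀ r ∈ Icc (0 : ℝ) R,
      Pminus N lam Lam (m - m') (l - l') - gam * |p - p'| - del * |u - u'|
          ≤ FF m l p u r - FF m' l' p' u' r ∧
        FF m l p u r - FF m' l' p' u' r
          ≤ Pplus N lam Lam (m - m') (l - l') + gam * |p - p'| + del * |u - u'|)
    (hF3 : ∀ m l p u m' l' p' u' : ℝ, ∀ r ∈ Icc (0 : ℝ) R,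
      -FF (m' - m) (l' - l) (p' - p) (u' - u) r ≤ FF m l p u r - FF m' l' p' u' r ∧
        FF m l p u r - FF m' l' p' u' r ≤ FF (m - m') (l - l') (p - p') (u - u') r)
    :
    ∃ κ : ℝ, 0 < κ ∧
      (∀ ε ∈ Ioo (0 : ℝ) R, ∀ f : ℝ → ℝ, ContinuousOn f (Icc 0 R) →
        ∃ u u' u'' : ℝ → ℝ,
          (RadC2 ε R u u' u'' ∧
            (∀ r ∈ Ioo ε R,
              FF (u'' r) (u' r / r) (u' r) (u r) r - κ * u r = f r) ∧
            u' ε = 0 ∧ u R = 0) ∧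
          ∀ v v' v'' : ℝ → ℝ,
            RadC2 ε R v v' v'' →
            (∀ r ∈ Ioo ε R,
              FF (v'' r) (v' r / r) (v' r) (v r) r - κ * v r = f r) →
            v' ε = 0 → v R = 0 →
            ∀ r ∈ Icc ε R, v r = u r) ∧
      (∀ f : ℝ → ℝ, ContinuousOn f (Icc 0 R) →
        ∃ C : ℝ, 0 < C ∧
          ∀ ε ∈ Ioo (0 : ℝ) R, ∀ u u' u'' : ℝ → ℝ,
            RadC2 ε R u u' u'' →
            (∀ r ∈ Ioo ε R,
              FF (u'' r) (u' r / r) (u' r) (u r) r - κ * u r = f r) →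
            u' ε = 0 → u R = 0 →
            (∀ r ∈ Icc ε R, |u' r / r| ≤ C) ∧ (∀ r ∈ Ioo ε R, |u'' r| ≤ C)) := by
  have hc : 0 ≤ Lam * ((N : ℝ) - 1) :=
    mul_nonneg (hlam.le.trans hLam) (sub_nonneg.2 (by exact_mod_cast hN))
  set c := Lam * ((N : ℝ) - 1) with hc_def
  have hmaxabs : ∀ x : ℝ, max x 0 ≤ |x| := fun x => max_le (le_abs_self x) (abs_nonneg x)
  have hP : ∀ m l p u m' l' p' u' : ℝ, ∀ r ∈ Icc (0 : ℝ) R,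
      FF m l p u r - FF m' l' p' u' r ≤ Lam * max (m - m') 0 - lam * max (-(m - m')) 0
        + c * |l - l'| + gam * |p - p'| + del * |u - u'| := by
    intro m l p u m' l' p' u' r hr
    have h1 := (hF2 m l p u m' l' p' u' r hr).2
    have h2 := Pplus_le hN hlam.le (Lam := Lam) (m - m') (l - l')
    have h3 := mul_le_mul_of_nonneg_left (hmaxabs (l - l')) hc
    linarith
  have hE : ∀ m l p u m' l' p' u' : ℝ, ∀ r ∈ Icc (0 : ℝ) R,
      lam * |m - m'| ≤ |FF m l p u r - FF m' l' p' u' r|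
        + c * |l - l'| + gam * |p - p'| + del * |u - u'| := by
    intro m l p u m' l' p' u' r hr
    have h1 := hP m l p u m' l' p' u' r hr
    have h2 := hP m' l' p' u' m l p u r hr
    rw [abs_sub_comm l', abs_sub_comm p', abs_sub_comm u'] at h2
    have h3 := le_abs_self (FF m l p u r - FF m' l' p' u' r)
    have h4 := neg_abs_le (FF m l p u r - FF m' l' p' u' r)
    rcases le_total 0 (m - m') with h | h
    · rw [max_eq_right (by linarith), max_eq_left (by linarith)] at h2
      rw [abs_of_nonneg h]
      linarith
    · rw [max_eq_right h, max_eq_left (by linarith)] at h1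
      rw [abs_of_nonpos h]
      linarith
  have hF0 : ∀ r ∈ Icc (0 : ℝ) R, FF 0 0 0 0 r = 0 := fun r hr => by
    simpa using hF1 0 le_rfl 0 0 0 0 r hr
  have hpos : ∀ m l p u : ℝ, ∀ r ∈ Icc (0 : ℝ) R, 0 ≤ l →
      lam * m ≤ |FF m l p u r| + gam * |p| + del * |u| := by
    intro m l p u r hr hl
    have h0 : 0 ≤ |FF m l p u r| + gam * |p| + del * |u| := by positivity
    rcases le_total m 0 with hm | hm
    · nlinarith
    have h1 := (hF2 m l p u 0 0 0 0 r hr).1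
    have h2 := le_Pminus hN hlam.le (Lam := Lam) (m - 0) (l - 0)
    rw [hF0 r hr] at h1
    simp only [sub_zero, max_eq_left hm, max_eq_right (neg_nonpos.2 hm),
      max_eq_right (neg_nonpos.2 hl), mul_zero] at h1 h2
    linarith [le_abs_self (FF m l p u r)]
  have hneg : ∀ m l p u : ℝ, ∀ r ∈ Icc (0 : ℝ) R, l ≤ 0 →
      lam * -m ≤ |FF m l p u r| + gam * |p| + del * |u| := by
    intro m l p u r hr hl
    have h0 : 0 ≤ |FF m l p u r| + gam * |p| + del * |u| := by positivity
    rcases le_total 0 m with hm | hm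
    · nlinarith
    have h1 := (hF2 m l p u 0 0 0 0 r hr).2
    have h2 := Pplus_le hN hlam.le (Lam := Lam) (m - 0) (l - 0)
    rw [hF0 r hr] at h1
    simp only [sub_zero, max_eq_right hm, max_eq_left (neg_nonneg.2 hm),
      max_eq_right hl, mul_zero] at h1 h2
    linarith [neg_abs_le (FF m l p u r)]
  refine ⟨del + 1, by linarith, fun ε hε f hf => ?_, fun f hf => ?_⟩
  · have hsub : Icc ε R ⊆ Icc 0 R := Icc_subset_Icc_left hε.1.le
    have hsub' : Ioo ε R ⊆ Icc 0 R := Ioo_subset_Icc_self.trans hsub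
    obtain ⟨u, u', u'', hu, hueq, hua, hub⟩ := exists_radC2_solution (κ := del + 1) hε.1 hε.2 hlam
      hc hgam.le hdel.le (by linarith) (hf.mono hsub) (hFcont.mono fun z hz => hsub hz)
      (fun m l p u m' l' p' u' r hr => hP m l p u m' l' p' u' r (hsub hr))
      (fun m l p u m' l' p' u' r hr => hE m l p u m' l' p' u' r (hsub hr))
    refine ⟨u, u', u'', ⟨hu, hueq, hua, hub⟩, fun v v' v'' hv hveq hva hvb r hr => ?_⟩
    have hP' : ∀ m l p u m' l' p' u' : ℝ, ∀ r ∈ Ioo ε R,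
        FF m l p u r - FF m' l' p' u' r ≤ Lam * max (m - m') 0 - lam * max (-(m - m')) 0
          + c * |l - l'| + gam * |p - p'| + del * |u - u'| :=
      fun m l p u m' l' p' u' r hr => hP m l p u m' l' p' u' r (hsub' hr)
    have h1 := hu.sub_le hε.1 hε.2 hlam hc hgam.le (lt_add_one del) le_rfl hP' hv hueq hveq
      (by simp) hua hva (by simp [hub, hvb]) r hr
    have h2 := hv.sub_le hε.1 hε.2 hlam hc hgam.le (lt_add_one del) le_rfl hP' hu hveq hueq
      (by simp) hva hua (by simp [hub, hvb]) r hr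
    linarith
  · obtain ⟨A, hA⟩ := isCompact_Icc.exists_bound_of_continuousOn hf
    have hA0 : 0 ≤ A := (norm_nonneg _).trans (hA 0 (left_mem_Icc.2 hR.le))
    set D := A + (del + 1) * A + del * A with hD
    have hD0 : 0 ≤ D := by positivity
    set K := (D / lam + 1) * Real.exp (gam / lam * R) with hK
    have hK0 : 0 < K := by positivity
    set C := (D + c * K + gam * (K * R)) / lam with hCdef
    have hC0 : 0 ≤ C := by positivity
    refine ⟨K + C, by positivity, fun ε hε u u' u'' hu hueq hua hub => ?_⟩
    have hsub : Icc ε R ⊆ Icc 0 R := Icc_subset_Icc_left hε.1.le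
    have hsub' : Ioo ε R ⊆ Icc 0 R := Ioo_subset_Icc_self.trans hsub
    have hP' : ∀ m l p u m' l' p' u' : ℝ, ∀ r ∈ Ioo ε R,
        FF m l p u r - FF m' l' p' u' r ≤ Lam * max (m - m') 0 - lam * max (-(m - m')) 0
          + c * |l - l'| + gam * |p - p'| + del * |u - u'| :=
      fun m l p u m' l' p' u' r hr => hP m l p u m' l' p' u' r (hsub' hr)
    have hzero : ∀ r ∈ Ioo ε R, FF 0 (0 / r) 0 0 r - (del + 1) * 0 = 0 := fun r hr => by
      simp [hF0 r (hsub' hr)]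
    have huA : ∀ r ∈ Icc ε R, |u r| ≤ A := by
      intro r hr
      have hfA : ∀ r ∈ Ioo ε R, |f r| ≤ A := fun r hr => hA r (hsub' hr)
      have h1 := hu.sub_le (f₂ := fun _ => 0) hε.1 hε.2 hlam hc hgam.le (lt_add_one del) hA0 hP'
        (radC2_zero ε R) hueq hzero
        (fun r hr => by linarith [(abs_le.1 (hfA r hr)).1]) hua rfl (by simpa [hub]) r hr
      have h2 := (radC2_zero ε R).sub_le (f₁ := fun _ => 0) hε.1 hε.2 hlam hc hgam.le
        (lt_add_one del) hA0 hP' hu hzero hueq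
        (fun r hr => by linarith [(abs_le.1 (hfA r hr)).2]) rfl hua (by simpa [hub]) r hr
      exact abs_le.2 ⟨by linarith, by linarith⟩
    have hrhs : ∀ r ∈ Ioo ε R,
        |FF (u'' r) (u' r / r) (u' r) (u r) r| + del * |u r| ≤ D := by
      intro r hr
      have h1 := huA r (Ioo_subset_Icc_self hr)
      have h2 : |f r| ≤ A := hA r (hsub' hr)
      have h3 : FF (u'' r) (u' r / r) (u' r) (u r) r = f r + (del + 1) * u r := by
        linarith [hueq r hr]
      have h4 : |(del + 1) * u r| ≤ (del + 1) * A := by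
        rw [abs_mul, abs_of_pos (by linarith)]
        gcongr
      have h5 := abs_add_le (f r) ((del + 1) * u r)
      have h6 := mul_le_mul_of_nonneg_left h1 hdel.le
      rw [h3]
      linarith
    have hexp : ∀ r ∈ Icc ε R,
        (D / lam + 1) * Real.exp (gam / lam * (R - ε)) * (r - ε) ≤ K * r := by
      intro r hr
      have h1 : Real.exp (gam / lam * (R - ε)) ≤ Real.exp (gam / lam * R) := by
        gcongr
        linarith [hε.1]
      have h2 : 0 ≤ r - ε := sub_nonneg.2 hr.1
      rw [hK]
      gcongr
      linarith [hε.1]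
    have hup : ∀ r ∈ Icc ε R, u' r ≤ K * r := fun r hr =>
      (le_mul_sub_of_deriv_le_of_pos (k := gam / lam) (c := D / lam) (by positivity)
        (by positivity) hu.2.1 hu.2.2.1 hua (fun r hr hq => by
          have h := hpos (u'' r) (u' r / r) (u' r) (u r) r (hsub' hr)
            (div_nonneg hq.le (hε.1.trans hr.1).le)
          have := hrhs r hr
          rw [abs_of_pos hq] at h
          rw [div_mul_eq_mul_div, ← add_div, le_div_iff₀ hlam]
          linarith) r hr).trans (hexp r hr)
    have hdown : ∀ r ∈ Icc ε R, -u' r ≤ K * r := fun r hr =>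
      (le_mul_sub_of_deriv_le_of_pos (q := fun r => -u' r) (q' := fun r => -u'' r)
        (k := gam / lam) (c := D / lam) (by positivity)
        (by positivity) hu.2.1.neg (fun r hr => (hu.2.2.1 r hr).neg) (by simp [hua])
        (fun r hr hq => by
          have hq' : u' r < 0 := neg_pos.1 hq
          have h := hneg (u'' r) (u' r / r) (u' r) (u r) r (hsub' hr)
            (div_nonpos_of_nonpos_of_nonneg hq'.le (hε.1.trans hr.1).le)
          have := hrhs r hr
          rw [abs_of_neg hq'] at h
          rw [div_mul_eq_mul_div, ← add_div, le_div_iff₀ hlam]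
          linarith) r hr).trans (hexp r hr)
    have habs : ∀ r ∈ Icc ε R, |u' r| ≤ K * r := fun r hr =>
      abs_le.2 ⟨by linarith [hdown r hr], hup r hr⟩
    have hquot : ∀ r ∈ Icc ε R, |u' r / r| ≤ K := fun r hr => by
      have hr0 : 0 < r := hε.1.trans_le hr.1
      rw [abs_div, abs_of_pos hr0, div_le_iff₀ hr0]
      exact habs r hr
    refine ⟨fun r hr => (hquot r hr).trans (by linarith), fun r hr => ?_⟩
    have hr' := Ioo_subset_Icc_self hr
    have h := hE (u'' r) (u' r / r) (u' r) (u r) 0 0 0 0 r (hsub' hr)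
    simp only [hF0 r (hsub' hr), sub_zero] at h
    have h1 := hrhs r hr
    have h2 := mul_le_mul_of_nonneg_left (hquot r hr') hc
    have h3 : |u' r| ≤ K * R := (habs r hr').trans (by gcongr; exact hr.2.le)
    have h4 := mul_le_mul_of_nonneg_left h3 hgam.le
    have h5 : |u'' r| ≤ C := by
      rw [hCdef, le_div_iff₀ hlam]
      linarith
    linarith
end

section
/- (Compactness estimate.) Assume 𝓕 satisfies (F1), (F2) and (F3), and let κ > 0 be a constant for which the problem 𝓕(u''(r), u'(r)/r, u'(r), u(r), r) − κ·u(r) = f(r) on (0,R), u'(0) = 0, u(R) = 0, has a unique solution in C²(0,R) ∩ C¹([0,R]) for every continuous f. Then for every M > 0 there exists a constant C > 0 such that: for every continuous f : [0,R] → ℝ with sup_{[0,R]} |f| ≤ M, the corresponding solution u satisfies |u'(r)/r| ≤ C and |u''(r)| ≤ C for all r ∈ (0,R]. -/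
open Set

open Filter Topology

namespace RadialEstimate

/-- The two-sided differential inequality satisfied by differences of solutions. -/
def PucciIneq (N : ℕ) (lam Lam gam D η R : ℝ) (w w' w'' : ℝ → ℝ) : Prop :=
  ∀ r ∈ Ioo (0 : ℝ) R,
    Pminus N lam Lam (w'' r) (w' r / r) ≤ gam * |w' r| + D * |w r| + η ∧
    -(gam * |w' r| + D * |w r| + η) ≤ Pplus N lam Lam (w'' r) (w' r / r)

lemma mul_le_of_pucci {N : ℕ} (hN : 1 ≤ N) {lam Lam x y g r : ℝ} (hlam : 0 < lam)
    (hg : 0 ≤ g) (hr : 0 < r)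
    (h1 : Pminus N lam Lam x (y / r) ≤ g) (h2 : -g ≤ Pplus N lam Lam x (y / r)) :
    y * x ≤ |y| * (g / lam) := by
  have hN' : (0 : ℝ) ≤ (N : ℝ) - 1 := by
    have : (1 : ℝ) ≤ N := by exact_mod_cast hN
    linarith
  unfold Pminus at h1
  unfold Pplus at h2
  have hgl : 0 ≤ g / lam := by positivity
  rcases le_total 0 y with hy | hy
  · rw [abs_of_nonneg hy]
    refine mul_le_mul_of_nonneg_left ?_ hy
    rcases le_total x 0 with hx | hx
    · linarith
    · have hb : 0 ≤ y / r := div_nonneg hy hr.le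
      rw [max_eq_left hx, max_eq_left hb, max_eq_right (by linarith), max_eq_right (by linarith)]
        at h1
      rw [le_div_iff₀ hlam]
      have := mul_nonneg hlam.le (mul_nonneg hN' hb)
      linarith
  · rw [abs_of_nonpos hy]
    have : -x ≤ g / lam := by
      rcases le_total 0 x with hx | hx
      · linarith
      · have hb : y / r ≤ 0 := div_nonpos_of_nonpos_of_nonneg hy hr.le
        rw [max_eq_right hx, max_eq_right hb, max_eq_left (by linarith),
          max_eq_left (by linarith)] at h2
        rw [le_div_iff₀ hlam]
        have := mul_nonneg hlam.le (mul_nonneg hN' (neg_nonneg.2 hb))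
        linarith
    have := mul_le_mul_of_nonneg_left this (neg_nonneg.2 hy)
    linarith

lemma abs_le_of_pucci {N : ℕ} (hN : 1 ≤ N) {lam Lam x b g : ℝ} (hlam : 0 < lam)
    (hLam : lam ≤ Lam)
    (h1 : Pminus N lam Lam x b ≤ g) (h2 : -g ≤ Pplus N lam Lam x b) :
    |x| ≤ (g + Lam * (((N : ℝ) - 1) * |b|)) / lam := by
  have hN' : (0 : ℝ) ≤ (N : ℝ) - 1 := by
    have : (1 : ℝ) ≤ N := by exact_mod_cast hN
    linarith
  unfold Pminus at h1
  unfold Pplus at h2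
  rw [le_div_iff₀ hlam]
  have hb := mul_nonneg hN' (abs_nonneg b)
  have e1 := mul_nonneg hlam.le hb
  have e2 := mul_nonneg (hlam.le.trans hLam) hb
  rcases le_total 0 x with hx | hx <;> rcases le_total 0 b with hb | hb
  all_goals
    simp only [max_eq_left, max_eq_right, hx, hb, neg_nonneg, neg_nonpos, abs_of_nonneg,
      abs_of_nonpos] at *
    linarith

/-- Gronwall bound for `w ^ 2 + w' ^ 2`. -/
lemma energy_bound {N : ℕ} (hN : 1 ≤ N) {R lam Lam gam D η : ℝ} (hlam : 0 < lam)
    (hgam : 0 < gam) (hD : 0 < D) (hη : 0 ≤ η) {w w' w'' : ℝ → ℝ}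
    (hw : RadC2 0 R w w' w'') (h0 : w' 0 = 0) (hP : PucciIneq N lam Lam gam D η R w w' w'')
    {r : ℝ} (hr : r ∈ Icc 0 R) :
    w r ^ 2 + w' r ^ 2 ≤
      Real.exp (((2 * gam + D + 1) / lam + D / lam + 1) * R) * (w 0 ^ 2 + η ^ 2 / lam * R) := by
  obtain ⟨hd1, hc1, hd2, -⟩ := hw
  set A := (2 * gam + D + 1) / lam + D / lam + 1 with hA
  have hApos : 0 < A := by positivity
  have hanti : AntitoneOn
      (fun r => Real.exp (-A * r) * (w r ^ 2 + w' r ^ 2) - η ^ 2 / lam * r) (Icc 0 R) := by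
    have hcw : ContinuousOn w (Icc 0 R) := fun x hx => (hd1 x hx).continuousWithinAt
    refine antitoneOn_of_hasDerivWithinAt_nonpos (convex_Icc 0 R)
      (f' := fun r => (Real.exp (-A * r) * -A) * (w r ^ 2 + w' r ^ 2) +
        Real.exp (-A * r) * (2 * w r * w' r + 2 * w' r * w'' r) - η ^ 2 / lam) ?_ ?_ ?_
    · fun_prop
    · rw [interior_Icc]
      intro x hx
      have e1 : HasDerivAt w (w' x) x :=
        (hd1 x (Ioo_subset_Icc_self hx)).hasDerivAt (Icc_mem_nhds hx.1 hx.2)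
      have e2 := hd2 x hx
      have e3 : HasDerivAt (fun r => Real.exp (-A * r)) (Real.exp (-A * x) * -A) x := by
        simpa using ((hasDerivAt_id x).const_mul (-A)).exp
      have := (e3.mul ((e1.pow 2).add (e2.pow 2))).sub
        ((hasDerivAt_id x).const_mul (η ^ 2 / lam))
      refine (this.congr_deriv ?_).hasDerivWithinAt
      simp
    · rw [interior_Icc]
      intro x hx
      obtain ⟨p1, p2⟩ := hP x hx
      have hg : 0 ≤ gam * |w' x| + D * |w x| + η := by positivity
      have hmul := mul_le_of_pucci hN hlam hg hx.1 p1 p2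
      have hE : 2 * w x * w' x + 2 * w' x * w'' x ≤ A * (w x ^ 2 + w' x ^ 2) + η ^ 2 / lam := by
        have a1 : |w' x| ^ 2 = w' x ^ 2 := sq_abs _
        have a2 : |w x| ^ 2 = w x ^ 2 := sq_abs _
        have s0 : 2 * w x * w' x ≤ w x ^ 2 + w' x ^ 2 := by nlinarith [sq_nonneg (w x - w' x)]
        have s1 : 2 * (|w' x| * (gam * |w' x| + D * |w x| + η)) ≤
            (2 * gam + D + 1 + D) * (w x ^ 2 + w' x ^ 2) + η ^ 2 := by
          have t1 : 2 * |w' x| * |w x| ≤ w x ^ 2 + w' x ^ 2 := by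
            nlinarith [sq_nonneg (|w' x| - |w x|)]
          have t2 : 2 * |w' x| * η ≤ w' x ^ 2 + η ^ 2 := by
            nlinarith [sq_nonneg (|w' x| - η)]
          have t3 := mul_le_mul_of_nonneg_left t1 hD.le
          have t4 : 0 ≤ gam * w x ^ 2 := by positivity
          have t5 : 0 ≤ D * (w x ^ 2 + w' x ^ 2) := by positivity
          have t6 : gam * |w' x| ^ 2 = gam * w' x ^ 2 := by rw [a1]
          nlinarith [sq_nonneg (w x)]
        have s2 : 2 * (|w' x| * ((gam * |w' x| + D * |w x| + η) / lam)) ≤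
            ((2 * gam + D + 1 + D) * (w x ^ 2 + w' x ^ 2) + η ^ 2) / lam := by
          rw [le_div_iff₀ hlam]
          calc _ = 2 * (|w' x| * (gam * |w' x| + D * |w x| + η)) := by field_simp
            _ ≤ _ := s1
        have s3 : A * (w x ^ 2 + w' x ^ 2) + η ^ 2 / lam =
            ((2 * gam + D + 1 + D) * (w x ^ 2 + w' x ^ 2) + η ^ 2) / lam
              + (w x ^ 2 + w' x ^ 2) := by
          rw [hA]; field_simp; ring
        linarith
      have hexp : Real.exp (-A * x) ≤ 1 := by
        rw [Real.exp_le_one_iff]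
        nlinarith [hx.1]
      have hnn : 0 ≤ η ^ 2 / lam := by positivity
      have k1 := mul_le_mul_of_nonneg_left hE (Real.exp_pos (-A * x)).le
      have k2 := mul_le_mul_of_nonneg_right hexp hnn
      nlinarith
  have hR : 0 ≤ R := hr.1.trans hr.2
  have h := hanti (left_mem_Icc.2 hR) hr hr.1
  simp only [mul_zero, Real.exp_zero, one_mul, sub_zero, h0] at h
  have hE : Real.exp (-A * r) * (w r ^ 2 + w' r ^ 2) ≤ w 0 ^ 2 + η ^ 2 / lam * R := by
    have : η ^ 2 / lam * r ≤ η ^ 2 / lam * R := mul_le_mul_of_nonneg_left hr.2 (by positivity)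
    nlinarith
  calc w r ^ 2 + w' r ^ 2
      = Real.exp (A * r) * (Real.exp (-A * r) * (w r ^ 2 + w' r ^ 2)) := by
        rw [← mul_assoc, ← Real.exp_add]; simp
    _ ≤ Real.exp (A * r) * (w 0 ^ 2 + η ^ 2 / lam * R) := by gcongr
    _ ≤ _ := by
        have := hr.2
        gcongr

/-- A function vanishing at `0` whose absolute value grows at rate at most `c` is bounded
by `c * r`. -/
lemma abs_le_mul_of_mul_deriv_le {R c : ℝ} {v v' : ℝ → ℝ} (hc : 0 ≤ c)
    (hcont : ContinuousOn v (Icc 0 R)) (hd : ∀ r ∈ Ioo 0 R, HasDerivAt v (v' r) r)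
    (h0 : v 0 = 0) (h : ∀ r ∈ Ioo 0 R, v r * v' r ≤ |v r| * c) {r : ℝ} (hr : r ∈ Icc 0 R) :
    |v r| ≤ c * r := by
  refine le_of_forall_pos_le_add fun ε hε => ?_
  have hpos : ∀ x, 0 < v x ^ 2 + ε ^ 2 := fun x => by positivity
  have hanti : AntitoneOn (fun r => Real.sqrt (v r ^ 2 + ε ^ 2) - c * r) (Icc 0 R) := by
    refine antitoneOn_of_hasDerivWithinAt_nonpos (convex_Icc 0 R)
      (f' := fun r => 2 * v r * v' r / (2 * Real.sqrt (v r ^ 2 + ε ^ 2)) - c) ?_ ?_ ?_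
    · fun_prop
    · rw [interior_Icc]
      intro x hx
      have := ((((hd x hx).pow 2).add_const (ε ^ 2)).sqrt (hpos x).ne').sub
        ((hasDerivAt_id x).const_mul c)
      refine (this.congr_deriv ?_).hasDerivWithinAt
      simp
    · rw [interior_Icc]
      intro x hx
      have hs := Real.sqrt_pos.2 (hpos x)
      have hle : |v x| ≤ Real.sqrt (v x ^ 2 + ε ^ 2) := Real.abs_le_sqrt (by nlinarith)
      rw [sub_nonpos, div_le_iff₀ (by positivity)]
      nlinarith [h x hx, mul_le_mul_of_nonneg_right hle hc]
  have hR : 0 ≤ R := hr.1.trans hr.2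
  have h := hanti (left_mem_Icc.2 hR) hr hr.1
  simp only [h0, mul_zero, sub_zero, ne_eq, OfNat.ofNat_ne_zero, not_false_eq_true, zero_pow,
    zero_add, Real.sqrt_sq hε.le] at h
  have hle : |v r| ≤ Real.sqrt (v r ^ 2 + ε ^ 2) := Real.abs_le_sqrt (by nlinarith)
  linarith

/-- The a priori estimate in terms of the value at the origin. -/
lemma apriori {N : ℕ} (hN : 1 ≤ N) {R lam Lam gam D : ℝ} (hR : 0 < R) (hlam : 0 < lam)
    (hLam : lam ≤ Lam) (hgam : 0 < gam) (hD : 0 < D) :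
    ∃ K : ℝ, 0 < K ∧ ∀ (w w' w'' : ℝ → ℝ) (a η : ℝ), 0 ≤ η → |w 0| ≤ a →
      RadC2 0 R w w' w'' → w' 0 = 0 → PucciIneq N lam Lam gam D η R w w' w'' →
      (∀ r ∈ Icc 0 R, |w r| ≤ K * (a + η)) ∧ (∀ r ∈ Icc 0 R, |w' r| ≤ K * (a + η) * r) ∧
      (∀ r ∈ Ioo 0 R, |w'' r| ≤ K * (a + η)) := by
  have hN' : (0 : ℝ) ≤ (N : ℝ) - 1 := by
    have : (1 : ℝ) ≤ N := by exact_mod_cast hN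
    linarith
  have hLam0 := hlam.trans_le hLam
  set B := Real.exp (((2 * gam + D + 1) / lam + D / lam + 1) * R) * (1 + R / lam) with hB
  have hBpos : 0 < B := by positivity
  set K₁ := Real.sqrt B with hK₁
  have hK₁pos : 0 < K₁ := Real.sqrt_pos.2 hBpos
  set G := gam * K₁ + D * K₁ + 1 with hG
  have hGpos : 0 < G := by positivity
  set K₃ := (G + Lam * (((N : ℝ) - 1) * (G / lam))) / lam with hK₃
  have hK₃pos : 0 < K₃ := by positivity
  refine ⟨K₁ + G / lam + K₃, by positivity, ?_⟩
  intro w w' w'' a η hη ha hw h0 hP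
  have ha0 : 0 ≤ a := (abs_nonneg _).trans ha
  have hS : 0 ≤ a + η := by positivity
  have hbd : ∀ r ∈ Icc 0 R, |w r| ≤ K₁ * (a + η) ∧ |w' r| ≤ K₁ * (a + η) := by
    intro r hr
    have hE := energy_bound hN hlam hgam hD hη hw h0 hP hr
    have hw0 : w 0 ^ 2 ≤ (a + η) ^ 2 := by
      rw [← sq_abs]
      gcongr
      linarith
    have hη2 : η ^ 2 ≤ (a + η) ^ 2 := by
      gcongr
      linarith
    have hE2 : w r ^ 2 + w' r ^ 2 ≤ B * (a + η) ^ 2 := by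
      refine hE.trans ?_
      rw [hB, mul_assoc]
      gcongr
      have := mul_le_mul_of_nonneg_left hη2 (by positivity : 0 ≤ R / lam)
      have e : η ^ 2 / lam * R = R / lam * η ^ 2 := by ring
      rw [e]
      linarith
    have hsq : (K₁ * (a + η)) ^ 2 = B * (a + η) ^ 2 := by
      rw [mul_pow, hK₁, Real.sq_sqrt hBpos.le]
    have hn : 0 ≤ K₁ * (a + η) := by positivity
    constructor <;> refine abs_le_of_sq_le_sq ?_ hn <;> rw [hsq] <;>
      nlinarith [sq_nonneg (w r), sq_nonneg (w' r)]
  have hg : ∀ r ∈ Icc 0 R, gam * |w' r| + D * |w r| + η ≤ G * (a + η) := by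
    intro r hr
    obtain ⟨b1, b2⟩ := hbd r hr
    have := mul_le_mul_of_nonneg_left b1 hD.le
    have := mul_le_mul_of_nonneg_left b2 hgam.le
    rw [hG]
    nlinarith
  have hP' : ∀ r ∈ Ioo 0 R, Pminus N lam Lam (w'' r) (w' r / r) ≤ G * (a + η) ∧
      -(G * (a + η)) ≤ Pplus N lam Lam (w'' r) (w' r / r) := by
    intro r hr
    have h1 := hP r hr
    have h2 := hg r (Ioo_subset_Icc_self hr)
    constructor <;> linarith
  have hGS : 0 ≤ G * (a + η) := by positivity
  have hw' : ∀ r ∈ Icc 0 R, |w' r| ≤ G * (a + η) / lam * r := fun r hr =>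
    abs_le_mul_of_mul_deriv_le (by positivity) hw.2.1 hw.2.2.1 h0
      (fun x hx => mul_le_of_pucci hN hlam hGS hx.1 (hP' x hx).1 (hP' x hx).2) hr
  have p1 : 0 ≤ K₁ * (a + η) := by positivity
  have p2 : 0 ≤ G / lam * (a + η) := by positivity
  have p3 : 0 ≤ K₃ * (a + η) := by positivity
  refine ⟨fun r hr => ?_, fun r hr => ?_, fun r hr => ?_⟩
  · have := (hbd r hr).1
    linarith
  · refine (hw' r hr).trans (mul_le_mul_of_nonneg_right ?_ hr.1)
    have : G * (a + η) / lam = G / lam * (a + η) := by ring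
    linarith
  · have h1 := abs_le_of_pucci hN hlam hLam (hP' r hr).1 (hP' r hr).2
    have h2 : |w' r / r| ≤ G * (a + η) / lam := by
      rw [abs_div, abs_of_pos hr.1, div_le_iff₀ hr.1]
      exact hw' r (Ioo_subset_Icc_self hr)
    have h3 : (G * (a + η) + Lam * (((N : ℝ) - 1) * |w' r / r|)) / lam ≤ K₃ * (a + η) := by
      have e : K₃ * (a + η) =
          (G * (a + η) + Lam * (((N : ℝ) - 1) * (G * (a + η) / lam))) / lam := by
        rw [hK₃]; ring
      rw [e]
      gcongr
    linarith

lemma exists_tendstoUniformlyOn {s : Set ℝ} {v : ℕ → ℝ → ℝ} {b : ℕ → ℝ}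
    (hb : Tendsto b atTop (𝓝 0)) (h : ∀ n m, ∀ r ∈ s, |v n r - v m r| ≤ b n + b m) :
    ∃ V : ℝ → ℝ, TendstoUniformlyOn v V atTop s := by
  have hc : UniformCauchySeqOn v atTop s := by
    rw [Metric.uniformCauchySeqOn_iff]
    intro ε hε
    obtain ⟨n₀, hn₀⟩ := eventually_atTop.1 (hb.eventually (gt_mem_nhds (half_pos hε)))
    refine ⟨n₀, fun m hm n hn x hx => ?_⟩
    rw [Real.dist_eq]
    linarith [h m n x hx, hn₀ m hm, hn₀ n hn]
  have hlim : ∀ x, ∃ y, x ∈ s → Tendsto (fun n => v n x) atTop (𝓝 y) := by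
    intro x
    by_cases hx : x ∈ s
    · obtain ⟨y, hy⟩ := cauchySeq_tendsto_of_complete (hc.cauchySeq hx)
      exact ⟨y, fun _ => hy⟩
    · exact ⟨0, fun h => (hx h).elim⟩
  choose V hV using hlim
  exact ⟨V, hc.tendstoUniformlyOn_of_tendsto fun x hx => hV x hx⟩

/-- Uniform `C²` limits of radial `C²` functions. -/
lemma exists_radC2_limit {R : ℝ} (hR : 0 < R) {u u' u'' : ℕ → ℝ → ℝ} {b : ℕ → ℝ}
    (hb : Tendsto b atTop (𝓝 0)) (h : ∀ n, RadC2 0 R (u n) (u' n) (u'' n))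
    (h0 : ∀ n m, ∀ r ∈ Icc 0 R, |u n r - u m r| ≤ b n + b m)
    (h1 : ∀ n m, ∀ r ∈ Icc 0 R, |u' n r - u' m r| ≤ b n + b m)
    (h2 : ∀ n m, ∀ r ∈ Ioo 0 R, |u'' n r - u'' m r| ≤ b n + b m) :
    ∃ U U' U'' : ℝ → ℝ, RadC2 0 R U U' U'' ∧
      (∀ r ∈ Icc 0 R, Tendsto (fun n => u n r) atTop (𝓝 (U r))) ∧
      (∀ r ∈ Icc 0 R, Tendsto (fun n => u' n r) atTop (𝓝 (U' r))) ∧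
      (∀ r ∈ Ioo 0 R, Tendsto (fun n => u'' n r) atTop (𝓝 (U'' r))) := by
  obtain ⟨U, hU⟩ := exists_tendstoUniformlyOn hb h0
  obtain ⟨U', hU'⟩ := exists_tendstoUniformlyOn hb h1
  obtain ⟨U'', hU''⟩ := exists_tendstoUniformlyOn hb h2
  have hcU : ContinuousOn U (Icc 0 R) := hU.continuousOn
    (Frequently.of_forall fun n x hx => ((h n).1 x hx).continuousWithinAt)
  have hcU' : ContinuousOn U' (Icc 0 R) := hU'.continuousOn
    (Frequently.of_forall fun n => (h n).2.1)
  have hcU'' : ContinuousOn U'' (Ioo 0 R) := hU''.continuousOn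
    (Frequently.of_forall fun n => (h n).2.2.2)
  have hdU : ∀ r ∈ Ioo 0 R, HasDerivAt U (U' r) r := fun r hr =>
    hasDerivAt_of_tendstoUniformlyOn isOpen_Ioo (hU'.mono Ioo_subset_Icc_self)
      (Eventually.of_forall fun n x hx =>
        ((h n).1 x (Ioo_subset_Icc_self hx)).hasDerivAt (Icc_mem_nhds hx.1 hx.2))
      (fun x hx => hU.tendsto_at (Ioo_subset_Icc_self hx)) hr
  have hdU' : ∀ r ∈ Ioo 0 R, HasDerivAt U' (U'' r) r := fun r hr =>
    hasDerivAt_of_tendstoUniformlyOn isOpen_Ioo hU''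
      (Eventually.of_forall fun n x hx => (h n).2.2.1 x hx)
      (fun x hx => hU'.tendsto_at (Ioo_subset_Icc_self hx)) hr
  have hdiff : DifferentiableOn ℝ U (Ioo 0 R) := fun x hx =>
    (hdU x hx).differentiableAt.differentiableWithinAt
  have hderiv : ∀ x ∈ Ioo 0 R, U' x = deriv U x := fun x hx => (hdU x hx).deriv.symm
  refine ⟨U, U', U'', ⟨fun r hr => ?_, hcU', hdU', hcU''⟩, fun r hr => hU.tendsto_at hr,
    fun r hr => hU'.tendsto_at hr, fun r hr => hU''.tendsto_at hr⟩
  rcases hr.1.eq_or_lt with rfl | hr0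
  · have hmem : Ioo 0 R ∈ 𝓝[>] (0 : ℝ) := Ioo_mem_nhdsGT hR
    refine (hasDerivWithinAt_Ici_of_tendsto_deriv hdiff
      ((hcU 0 hr).mono Ioo_subset_Icc_self) hmem ?_).mono Icc_subset_Ici_self
    refine Tendsto.congr' (eventually_of_mem hmem hderiv) ?_
    exact (hcU' 0 hr).mono_left (nhdsWithin_le_of_mem
      (mem_of_superset hmem Ioo_subset_Icc_self))
  rcases hr.2.eq_or_lt with rfl | hrR
  · have hmem : Ioo 0 r ∈ 𝓝[<] r := Ioo_mem_nhdsLT hR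
    refine (hasDerivWithinAt_Iic_of_tendsto_deriv hdiff
      ((hcU r hr).mono Ioo_subset_Icc_self) hmem ?_).mono Icc_subset_Iic_self
    refine Tendsto.congr' (eventually_of_mem hmem hderiv) ?_
    exact (hcU' r hr).mono_left (nhdsWithin_le_of_mem
      (mem_of_superset hmem Ioo_subset_Icc_self))
  · exact (hdU r ⟨hr0, hrR⟩).hasDerivWithinAt

lemma radC2_sub {e R : ℝ} {u u' u'' v v' v'' : ℝ → ℝ} (hu : RadC2 e R u u' u'')
    (hv : RadC2 e R v v' v'') :
    RadC2 e R (fun r => u r - v r) (fun r => u' r - v' r) (fun r => u'' r - v'' r) :=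
  ⟨fun r hr => (hu.1 r hr).sub (hv.1 r hr), hu.2.1.sub hv.2.1,
    fun r hr => (hu.2.2.1 r hr).sub (hv.2.2.1 r hr), hu.2.2.2.sub hv.2.2.2⟩

lemma radC2_const_mul {e R : ℝ} {u u' u'' : ℝ → ℝ} (c : ℝ) (hu : RadC2 e R u u' u'') :
    RadC2 e R (fun r => c * u r) (fun r => c * u' r) (fun r => c * u'' r) :=
  ⟨fun r hr => (hu.1 r hr).const_mul c, hu.2.1.const_mul c,
    fun r hr => (hu.2.2.1 r hr).const_mul c, hu.2.2.2.const_mul c⟩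

lemma radC2_zero (e R : ℝ) : RadC2 e R (fun _ => 0) (fun _ => 0) (fun _ => 0) :=
  ⟨fun r _ => hasDerivWithinAt_const r _ 0, continuousOn_const,
    fun r _ => hasDerivAt_const r 0, continuousOn_const⟩

/-- The radial equation with homogeneous Neumann condition at the origin. -/
def RadSol (FF : ℝ → ℝ → ℝ → ℝ → ℝ → ℝ) (κ R : ℝ) (f u u' u'' : ℝ → ℝ) : Prop :=
  RadC2 0 R u u' u'' ∧
    (∀ r ∈ Ioo (0 : ℝ) R, FF (u'' r) (u' r / r) (u' r) (u r) r - κ * u r = f r) ∧ u' 0 = 0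

variable {N : ℕ} {R lam Lam gam del κ : ℝ} {FF : ℝ → ℝ → ℝ → ℝ → ℝ → ℝ}

lemma RadSol.pucciIneq_sub (hκ : 0 < κ)
    (hF2 : ∀ m l p u m' l' p' u' : ℝ, ∀ r ∈ Icc (0 : ℝ) R,
      Pminus N lam Lam (m - m') (l - l') - gam * |p - p'| - del * |u - u'|
          ≤ FF m l p u r - FF m' l' p' u' r ∧
        FF m l p u r - FF m' l' p' u' r
          ≤ Pplus N lam Lam (m - m') (l - l') + gam * |p - p'| + del * |u - u'|)
    {f u u' u'' g v v' v'' : ℝ → ℝ} (hu : RadSol FF κ R f u u' u'')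
    (hv : RadSol FF κ R g v v' v'') {η : ℝ} (hη : ∀ r ∈ Ioo 0 R, |f r - g r| ≤ η) :
    PucciIneq N lam Lam gam (del + κ) η R (fun r => u r - v r) (fun r => u' r - v' r)
      (fun r => u'' r - v'' r) := by
  intro r hr
  have h := hF2 (u'' r) (u' r / r) (u' r) (u r) (v'' r) (v' r / r) (v' r) (v r) r
    (Ioo_subset_Icc_self hr)
  have e1 := hu.2.1 r hr
  have e2 := hv.2.1 r hr
  rw [← sub_div] at h
  have e3 := abs_le.1 (hη r hr)
  have e4 : |κ * (u r - v r)| = κ * |u r - v r| := by rw [abs_mul, abs_of_pos hκ]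
  have e5 := abs_le.1 e4.le
  constructor <;> linarith [h.1, h.2, e3.1, e3.2, e5.1, e5.2]

lemma RadSol.smul
    (hF1 : ∀ s : ℝ, 0 ≤ s → ∀ m l p u : ℝ, ∀ r ∈ Icc (0 : ℝ) R,
      FF (s * m) (s * l) (s * p) (s * u) r = s * FF m l p u r)
    {f u u' u'' : ℝ → ℝ} (hu : RadSol FF κ R f u u' u'') {s : ℝ} (hs : 0 ≤ s) :
    RadSol FF κ R (fun r => s * f r) (fun r => s * u r) (fun r => s * u' r)
      (fun r => s * u'' r) := by
  refine ⟨radC2_const_mul s hu.1, fun r hr => ?_, by simp [hu.2.2]⟩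
  dsimp only
  rw [mul_div_assoc, hF1 s hs _ _ _ _ r (Ioo_subset_Icc_self hr), ← hu.2.1 r hr]
  ring

lemma radSol_zero
    (hF1 : ∀ s : ℝ, 0 ≤ s → ∀ m l p u : ℝ, ∀ r ∈ Icc (0 : ℝ) R,
      FF (s * m) (s * l) (s * p) (s * u) r = s * FF m l p u r) :
    RadSol FF κ R (fun _ => 0) (fun _ => 0) (fun _ => 0) (fun _ => 0) := by
  refine ⟨radC2_zero 0 R, fun r hr => ?_, rfl⟩
  have := hF1 0 le_rfl 0 0 0 0 r (Ioo_subset_Icc_self hr)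
  simpa using this

/-- If the homogeneous Dirichlet problem has only the trivial solution, solutions of the Dirichlet
problem with prescribed nonzero value at the origin have right-hand sides bounded away from `0`. -/
lemma exists_gap (hN : 1 ≤ N) (hR : 0 < R) (hlam : 0 < lam) (hLam : lam ≤ Lam) (hgam : 0 < gam)
    (hdel : 0 < del) (hκ : 0 < κ)
    (hFcont : ContinuousOn
      (fun z : ℝ × ℝ × ℝ × ℝ × ℝ => FF z.1 z.2.1 z.2.2.1 z.2.2.2.1 z.2.2.2.2)
      {z : ℝ × ℝ × ℝ × ℝ × ℝ | z.2.2.2.2 ∈ Icc 0 R})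
    (hF2 : ∀ m l p u m' l' p' u' : ℝ, ∀ r ∈ Icc (0 : ℝ) R,
      Pminus N lam Lam (m - m') (l - l') - gam * |p - p'| - del * |u - u'|
          ≤ FF m l p u r - FF m' l' p' u' r ∧
        FF m l p u r - FF m' l' p' u' r
          ≤ Pplus N lam Lam (m - m') (l - l') + gam * |p - p'| + del * |u - u'|)
    (huniq : ∀ v v' v'' : ℝ → ℝ, RadSol FF κ R (fun _ => 0) v v' v'' → v R = 0 → v 0 = 0)
    {s : ℝ} (hs : s ≠ 0) :
    ∃ ε : ℝ, 0 < ε ∧ ∀ f u u' u'' : ℝ → ℝ, RadSol FF κ R f u u' u'' → u R = 0 → u 0 = s →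
      ¬ ∀ r ∈ Ioo 0 R, |f r| ≤ ε := by
  by_contra! hcon
  choose f u u' u'' hsol hRn h0n hf using fun n : ℕ =>
    hcon (1 / ((n : ℝ) + 1)) (by positivity)
  obtain ⟨K, hK, hest⟩ := apriori hN hR hlam hLam hgam (add_pos hdel hκ)
  have hε : Tendsto (fun n : ℕ => 1 / ((n : ℝ) + 1)) atTop (𝓝 0) :=
    tendsto_one_div_add_atTop_nhds_zero_nat
  set b : ℕ → ℝ := fun n => K * (1 + R) * (1 / ((n : ℝ) + 1)) with hbdef
  have hb : Tendsto b atTop (𝓝 0) := by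
    simpa only [mul_zero] using hε.const_mul (K * (1 + R))
  have hdiff : ∀ n m : ℕ, _ := fun n m =>
    hest _ _ _ 0 (1 / ((n : ℝ) + 1) + 1 / ((m : ℝ) + 1)) (by positivity)
      (by simp [h0n]) (radC2_sub (hsol n).1 (hsol m).1) (by simp [(hsol n).2.2, (hsol m).2.2])
      ((hsol n).pucciIneq_sub hκ hF2 (hsol m) (fun r hr =>
        (abs_sub _ _).trans (add_le_add (hf n r hr) (hf m r hr))))
  have hbnd : ∀ n m : ℕ, K * (0 + (1 / ((n : ℝ) + 1) + 1 / ((m : ℝ) + 1))) ≤ b n + b m := by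
    intro n m
    have : 0 ≤ K * R * (1 / ((n : ℝ) + 1) + 1 / ((m : ℝ) + 1)) := by positivity
    simp only [hbdef]
    linarith
  have hbnd' : ∀ n m : ℕ, K * (0 + (1 / ((n : ℝ) + 1) + 1 / ((m : ℝ) + 1))) * R ≤ b n + b m := by
    intro n m
    have : 0 ≤ K * (1 / ((n : ℝ) + 1) + 1 / ((m : ℝ) + 1)) := by positivity
    simp only [hbdef]
    linarith
  obtain ⟨U, U', U'', hUC, hU, hU', hU''⟩ := exists_radC2_limit hR hb (fun n => (hsol n).1)
    (fun n m r hr => ((hdiff n m).1 r hr).trans (hbnd n m))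
    (fun n m r hr => ((hdiff n m).2.1 r hr).trans
      ((mul_le_mul_of_nonneg_left hr.2 (by positivity)).trans (hbnd' n m)))
    (fun n m r hr => ((hdiff n m).2.2 r hr).trans (hbnd n m))
  have hmem0 : (0 : ℝ) ∈ Icc 0 R := left_mem_Icc.2 hR.le
  have hmemR : R ∈ Icc 0 R := right_mem_Icc.2 hR.le
  have hU0 : U 0 = s := tendsto_nhds_unique (hU 0 hmem0) (by simp [h0n])
  have hUR : U R = 0 := tendsto_nhds_unique (hU R hmemR) (by simp [hRn])
  have hU'0 : U' 0 = 0 :=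
    tendsto_nhds_unique (hU' 0 hmem0) (by simp [fun n => (hsol n).2.2])
  refine hs (hU0 ▸ huniq U U' U'' ⟨hUC, fun r hr => ?_, hU'0⟩ hUR)
  have hr' := Ioo_subset_Icc_self hr
  have ht : Tendsto (fun n => ((u'' n r, u' n r / r, u' n r, u n r, r) : ℝ × ℝ × ℝ × ℝ × ℝ)) atTop
      (𝓝[{z : ℝ × ℝ × ℝ × ℝ × ℝ | z.2.2.2.2 ∈ Icc 0 R}] (U'' r, U' r / r, U' r, U r, r)) := by
    refine tendsto_nhdsWithin_iff.2 ⟨?_, Eventually.of_forall fun n => hr'⟩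
    exact (hU'' r hr).prodMk_nhds (((hU' r hr').div_const r).prodMk_nhds
      ((hU' r hr').prodMk_nhds ((hU r hr').prodMk_nhds tendsto_const_nhds)))
  have hFt := (hFcont (U'' r, U' r / r, U' r, U r, r) hr').tendsto.comp ht
  have hlim := hFt.sub ((hU r hr').const_mul κ)
  have hf0 : Tendsto (fun n => f n r) atTop (𝓝 0) :=
    squeeze_zero_norm (fun n => hf n r hr) hε
  refine tendsto_nhds_unique hlim (hf0.congr fun n => ?_)
  exact ((hsol n).2.1 r hr).symm

end RadialEstimate

open RadialEstimate

/-- compactness estimate: if `κ > 0` is such that the radial Dirichlet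
problem with parameter `κ` is uniquely solvable for every continuous `f`, then for
every `M > 0` there is `C > 0` such that any solution corresponding to `f` with
`sup |f| ≤ M` satisfies `|u'(r)/r| ≤ C` and `|u''(r)| ≤ C`. -/
theorem stmt_17
    (N : ℕ) (hN : 1 ≤ N) (R lam Lam gam del : ℝ) (hR : 0 < R)
    (hlam : 0 < lam) (hLam : lam ≤ Lam) (hgam : 0 < gam) (hdel : 0 < del)
    (FF : ℝ → ℝ → ℝ → ℝ → ℝ → ℝ)
    (hFcont : ContinuousOn
      (fun z : ℝ × ℝ × ℝ × ℝ × ℝ => FF z.1 z.2.1 z.2.2.1 z.2.2.2.1 z.2.2.2.2)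
      {z : ℝ × ℝ × ℝ × ℝ × ℝ | z.2.2.2.2 ∈ Icc 0 R})
    (hF1 : ∀ s : ℝ, 0 ≤ s → ∀ m l p u : ℝ, ∀ r ∈ Icc (0 : ℝ) R,
      FF (s * m) (s * l) (s * p) (s * u) r = s * FF m l p u r)
    (hF2 : ∀ m l p u m' l' p' u' : ℝ, ∀ r ∈ Icc (0 : ℝ) R,
      Pminus N lam Lam (m - m') (l - l') - gam * |p - p'| - del * |u - u'|
          ≤ FF m l p u r - FF m' l' p' u' r ∧
        FF m l p u r - FF m' l' p' u' r
          ≤ Pplus N lam Lam (m - m') (l - l') + gam * |p - p'| + del * |u - u'|)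
    (hF3 : ∀ m l p u m' l' p' u' : ℝ, ∀ r ∈ Icc (0 : ℝ) R,
      -FF (m' - m) (l' - l) (p' - p) (u' - u) r ≤ FF m l p u r - FF m' l' p' u' r ∧
        FF m l p u r - FF m' l' p' u' r ≤ FF (m - m') (l - l') (p - p') (u - u') r)
    (κ : ℝ) (hκ : 0 < κ)
    (hsolv : ∀ f : ℝ → ℝ, ContinuousOn f (Icc 0 R) →
      ∃ u u' u'' : ℝ → ℝ,
        (RadC2 0 R u u' u'' ∧
          (∀ r ∈ Ioo (0 : ℝ) R,
            FF (u'' r) (u' r / r) (u' r) (u r) r - κ * u r = f r) ∧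
          u' 0 = 0 ∧ u R = 0) ∧
        ∀ v v' v'' : ℝ → ℝ,
          RadC2 0 R v v' v'' →
          (∀ r ∈ Ioo (0 : ℝ) R,
            FF (v'' r) (v' r / r) (v' r) (v r) r - κ * v r = f r) →
          v' 0 = 0 → v R = 0 →
          ∀ r ∈ Icc (0 : ℝ) R, v r = u r) :
    ∀ M : ℝ, 0 < M →
      ∃ C : ℝ, 0 < C ∧
        ∀ f : ℝ → ℝ, ContinuousOn f (Icc 0 R) → (∀ r ∈ Icc (0 : ℝ) R, |f r| ≤ M) →
          ∀ u u' u'' : ℝ → ℝ,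
            RadC2 0 R u u' u'' →
            (∀ r ∈ Ioo (0 : ℝ) R,
              FF (u'' r) (u' r / r) (u' r) (u r) r - κ * u r = f r) →
            u' 0 = 0 → u R = 0 →
            (∀ r ∈ Ioc (0 : ℝ) R, |u' r / r| ≤ C) ∧ (∀ r ∈ Ioo (0 : ℝ) R, |u'' r| ≤ C) := by
  intro M hM
  have huniq : ∀ v v' v'' : ℝ → ℝ, RadSol FF κ R (fun _ => 0) v v' v'' → v R = 0 → v 0 = 0 := by
    intro v v' v'' hv hvR
    obtain ⟨u, u', u'', -, hu⟩ := hsolv (fun _ => 0) continuousOn_const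
    have hmem : (0 : ℝ) ∈ Icc 0 R := left_mem_Icc.2 hR.le
    have hz := radSol_zero (κ := κ) hF1
    rw [hu v v' v'' hv.1 hv.2.1 hv.2.2 hvR 0 hmem, ← hu _ _ _ hz.1 hz.2.1 hz.2.2 rfl 0 hmem]
  obtain ⟨ε₁, hε₁, hgap₁⟩ := exists_gap hN hR hlam hLam hgam hdel hκ hFcont hF2 huniq
    (one_ne_zero (α := ℝ))
  obtain ⟨ε₂, hε₂, hgap₂⟩ := exists_gap hN hR hlam hLam hgam hdel hκ hFcont hF2 huniq
    (neg_ne_zero.2 (one_ne_zero (α := ℝ)))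
  obtain ⟨K, hK, hest⟩ := apriori hN hR hlam hLam hgam (add_pos hdel hκ)
  refine ⟨K * (M / ε₁ + M / ε₂ + M), by positivity, ?_⟩
  intro f _ hfM u u' u'' hu heq hu'0 huR
  have hsol : RadSol FF κ R f u u' u'' := ⟨hu, heq, hu'0⟩
  have hscale : ∀ ε, 0 < ε → u 0 ≠ 0 → M / ε < |u 0| → ∀ r ∈ Ioo 0 R, |(|u 0|⁻¹ * f r)| ≤ ε := by
    intro ε hε h0 hlt r hr
    have hpos : 0 < |u 0| := abs_pos.2 h0
    rw [abs_mul, abs_inv, abs_abs, inv_mul_le_iff₀ hpos]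
    rw [div_lt_iff₀ hε] at hlt
    exact (hfM r (Ioo_subset_Icc_self hr)).trans hlt.le
  have hM1 : 0 < M / ε₁ := by positivity
  have hM2 : 0 < M / ε₂ := by positivity
  have hu0 : |u 0| ≤ M / ε₁ + M / ε₂ := by
    by_contra! hlt
    have hne : u 0 ≠ 0 := by
      intro h
      rw [h, abs_zero] at hlt
      linarith
    have hsc := hsol.smul hF1 (inv_nonneg.2 (abs_nonneg (u 0)))
    rcases hne.lt_or_gt with hneg | hpos
    · refine hgap₂ _ _ _ _ hsc (by simp [huR]) ?_ (hscale ε₂ hε₂ hne (by linarith))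
      rw [abs_of_neg hneg, inv_neg, neg_mul, inv_mul_cancel₀ hne]
    · refine hgap₁ _ _ _ _ hsc (by simp [huR]) ?_ (hscale ε₁ hε₁ hne (by linarith))
      rw [abs_of_pos hpos, inv_mul_cancel₀ hne]
  have hP := hsol.pucciIneq_sub hκ hF2 (radSol_zero hF1) (η := M)
    (fun r hr => by simpa using hfM r (Ioo_subset_Icc_self hr))
  simp only [sub_zero] at hP
  obtain ⟨-, h1, h2⟩ := hest u u' u'' _ M hM.le hu0 hu hu'0 hP
  refine ⟨fun r hr => ?_, h2⟩
  rw [abs_div, abs_of_pos hr.1, div_le_iff₀ hr.1]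
  exact h1 r (Ioc_subset_Icc_self hr)
end
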